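/- arXiv:1712.03639 — 6 statements merged into one kernel-verified Lean document; each statement's English description precedes it below -/
import Mathlib

section
/- Let n and r be positive integers with r dividing n, and let σ, π ∈ S_n. Then the r-regular Ulam distance between the r-regular multipermutations m_σ^r and m_π^r, defined as the minimum of the Ulam distances d∘(σ',π') = n − ℓ(σ',π') over all σ' with m_{σ'}^r = m_σ^r and all π' with m_{π'}^r = m_π^r, equals n − ℓ(m_σ^r, m_π^r), the length n minus the length of a longest common subsequence of the two multipermutations. -/
/-- Length of a longest common subsequence of two lists. -/
noncomputable def lcsLen {α : Type*} (x y : List α) : ℕ :=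
  sSup {k | ∃ z : List α, z.length = k ∧ z.Sublist x ∧ z.Sublist y}
/-- The sequence `(σ(1), …, σ(n))` associated with a permutation `σ ∈ S_n`
(positions are 0-indexed here, values 1-indexed). -/
def permSeq {n : ℕ} (σ : Equiv.Perm (Fin n)) : List ℕ :=
  List.ofFn fun i => (σ i : ℕ) + 1

/-- The Ulam distance `d∘(σ,π) = n - ℓ(σ,π)` between permutations. -/
noncomputable def pdist {n : ℕ} (σ π : Equiv.Perm (Fin n)) : ℕ :=
  n - lcsLen (permSeq σ) (permSeq π)

/-- The permutation Ulam sphere of radius `t` centered at `σ`. -/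
noncomputable def psphere {n : ℕ} (σ : Equiv.Perm (Fin n)) (t : ℕ) :
    Set (Equiv.Perm (Fin n)) :=
  {π | pdist σ π ≤ t}
/-- The `r`-regular multipermutation `m_σ^r` of `σ`, with values in `{1, …, n/r}`:
`m_σ^r(i) = j` iff `(j-1)r + 1 ≤ σ(i) ≤ jr` (with `σ(i)` read as a 1-indexed value). -/
def mreg {n : ℕ} (r : ℕ) (σ : Equiv.Perm (Fin n)) : Fin n → ℕ :=
  fun i => (σ i : ℕ) / r + 1

theorem bddAbove_length_common_sublist {α : Type*} (x y : List α) :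
    BddAbove {k | ∃ z : List α, z.length = k ∧ z.Sublist x ∧ z.Sublist y} :=
  ⟨x.length, by rintro _ ⟨z, rfl, hx, -⟩; exact hx.length_le⟩

theorem length_le_lcsLen {α : Type*} {x y z : List α} (hx : z.Sublist x) (hy : z.Sublist y) :
    z.length ≤ lcsLen x y :=
  le_csSup (bddAbove_length_common_sublist x y) ⟨z, rfl, hx, hy⟩

theorem exists_length_eq_lcsLen {α : Type*} (x y : List α) :
    ∃ z : List α, z.length = lcsLen x y ∧ z.Sublist x ∧ z.Sublist y :=
  Nat.sSup_mem (s := {k | ∃ z : List α, z.length = k ∧ z.Sublist x ∧ z.Sublist y})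
    ⟨0, [], rfl, List.nil_sublist x, List.nil_sublist y⟩ (bddAbove_length_common_sublist x y)

theorem lcsLen_le_lcsLen_map {α β : Type*} (f : α → β) (x y : List α) :
    lcsLen x y ≤ lcsLen (x.map f) (y.map f) := by
  obtain ⟨z, hz, hx, hy⟩ := exists_length_eq_lcsLen x y
  rw [← hz, ← List.length_map (f := f)]
  exact length_le_lcsLen (hx.map f) (hy.map f)

theorem sublist_ofFn_iff {α : Type*} {n : ℕ} {z : List α} {u : Fin n → α} :
    z.Sublist (List.ofFn u) ↔ ∃ f : Fin z.length ↪o Fin n, ∀ i, z.get i = u (f i) := by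
  rw [List.sublist_iff_exists_fin_orderEmbedding_get_eq]
  constructor
  · rintro ⟨f, hf⟩
    exact ⟨f.trans (Fin.castOrderIso List.length_ofFn).toOrderEmbedding, fun i => by
      simpa [Fin.cast] using hf i⟩
  · rintro ⟨f, hf⟩
    exact ⟨f.trans (Fin.castOrderIso List.length_ofFn.symm).toOrderEmbedding, fun i => by
      simpa [Fin.cast] using hf i⟩

theorem ofFn_comp_sublist_ofFn {α : Type*} {k n : ℕ} (u : Fin n → α) (f : Fin k ↪o Fin n) :
    (List.ofFn (u ∘ f)).Sublist (List.ofFn u) :=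
  sublist_ofFn_iff.2
    ⟨(Fin.castOrderIso List.length_ofFn).toOrderEmbedding.trans f, fun i => by simp [Fin.cast]⟩

/-- A finite partial injection preserving the fibres of `p` extends to a permutation
preserving the fibres of `p`. -/
theorem exists_perm_comp_eq_and_apply_eq {ι α β : Type*} (p : α → β) {a b : ι → α}
    (ha : a.Injective) (hb : b.Injective) (hab : ∀ i, p (a i) = p (b i)) (s : Finset ι) :
    ∃ τ : Equiv.Perm α, (∀ x, p (τ x) = p x) ∧ ∀ i ∈ s, τ (a i) = b i := by
  classical
  induction s using Finset.induction_on with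
  | empty => exact ⟨1, by simp, by simp⟩
  | insert j s hj ih =>
    obtain ⟨τ, hp, hs⟩ := ih
    refine ⟨Equiv.swap (τ (a j)) (b j) * τ, fun x => ?_, fun i hi => ?_⟩
    · rw [Equiv.Perm.mul_apply, Equiv.swap_apply_def]
      split_ifs with h1 h2
      · rw [← hab, ← hp x, h1, hp]
      · rw [← hp x, h2, hp, hab]
      · exact hp x
    · rw [Equiv.Perm.mul_apply]
      rcases Finset.mem_insert.1 hi with rfl | hi
      · exact Equiv.swap_apply_left _ _
      · have hij : i ≠ j := fun h => hj (h ▸ hi)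
        rw [Equiv.swap_apply_of_ne_of_ne (τ.injective.ne (ha.ne hij)), hs i hi]
        rw [hs i hi]
        exact hb.ne hij

theorem map_permSeq {n : ℕ} (r : ℕ) (σ : Equiv.Perm (Fin n)) :
    (permSeq σ).map (fun v => (v - 1) / r + 1) = List.ofFn (mreg r σ) := by
  simp only [permSeq, List.map_ofFn]
  rfl

theorem lcsLen_permSeq_le {n : ℕ} (r : ℕ) (σ π : Equiv.Perm (Fin n)) :
    lcsLen (permSeq σ) (permSeq π) ≤ lcsLen (List.ofFn (mreg r σ)) (List.ofFn (mreg r π)) := by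
  rw [← map_permSeq, ← map_permSeq]
  exact lcsLen_le_lcsLen_map _ _ _

theorem exists_mreg_eq_and_lcsLen_le {n : ℕ} (r : ℕ) (σ π : Equiv.Perm (Fin n)) :
    ∃ π' : Equiv.Perm (Fin n), mreg r π' = mreg r π ∧
      lcsLen (List.ofFn (mreg r σ)) (List.ofFn (mreg r π)) ≤
        lcsLen (permSeq σ) (permSeq π') := by
  obtain ⟨z, hz, hσ, hπ⟩ :=
    exists_length_eq_lcsLen (List.ofFn (mreg r σ)) (List.ofFn (mreg r π))
  obtain ⟨f, hf⟩ := sublist_ofFn_iff.1 hσ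
  obtain ⟨g, hg⟩ := sublist_ofFn_iff.1 hπ
  obtain ⟨τ, hτ, hτg⟩ := exists_perm_comp_eq_and_apply_eq
    (fun v : Fin n => (v : ℕ) / r + 1) (π.injective.comp g.injective)
    (σ.injective.comp f.injective) (fun i => (hg i).symm.trans (hf i)) Finset.univ
  refine ⟨τ * π, funext fun i => hτ (π i), ?_⟩
  have hseq : (fun i => (σ i : ℕ) + 1) ∘ f = (fun i => ((τ * π) i : ℕ) + 1) ∘ g :=
    funext fun i => congrArg (fun v : Fin n => (v : ℕ) + 1) (hτg i (Finset.mem_univ i)).symm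
  have hsub := ofFn_comp_sublist_ofFn (fun i => ((τ * π) i : ℕ) + 1) g
  rw [← hseq] at hsub
  have hle := length_le_lcsLen (ofFn_comp_sublist_ofFn (fun i => (σ i : ℕ) + 1) f) hsub
  rwa [List.length_ofFn, hz] at hle

/-- The `r`-regular Ulam distance between `m_σ^r` and `m_π^r`, defined as
the minimum of `n - ℓ(σ',π')` over all `σ'`, `π'` with `m_{σ'}^r = m_σ^r` and
`m_{π'}^r = m_π^r`, equals `n - ℓ(m_σ^r, m_π^r)`. -/
theorem rRegularUlamDist_eq_sub_lcs (n r : ℕ) (hn : 0 < n) (hr : 0 < r) (hdvd : r ∣ n)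
    (σ π : Equiv.Perm (Fin n)) :
    sInf {d : ℕ | ∃ σ' π' : Equiv.Perm (Fin n),
        mreg r σ' = mreg r σ ∧ mreg r π' = mreg r π ∧
        d = n - lcsLen (permSeq σ') (permSeq π')} =
      n - lcsLen (List.ofFn (mreg r σ)) (List.ofFn (mreg r π)) := by
  refine IsLeast.csInf_eq ⟨?_, ?_⟩
  · obtain ⟨π', hπ', hle⟩ := exists_mreg_eq_and_lcsLen_le r σ π
    refine ⟨σ, π', rfl, hπ', ?_⟩
    rw [← hπ'] at hle ⊢
    rw [le_antisymm hle (lcsLen_permSeq_le r σ π')]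
  · rintro _ ⟨σ', π', hσ', hπ', rfl⟩
    rw [← hσ', ← hπ']
    exact Nat.sub_le_sub_left (lcsLen_permSeq_le r σ' π') n
end

section
/- Let n > 3 be an integer and σ ∈ S_n. Then the permutation Ulam sphere of radius 2 centered at σ has size |S(σ, 2)| = 1 + (n−1)² + (n(n−3)/2)² + ((n−1)(n−2)/2)². -/
open Finset Equiv

/-- The positions `i ≥ v` can be completed to a set of at most `k` positions outside of which
`π` is increasing. -/
def IncreasingOff {n : ℕ} (k : ℕ) (v : Fin (n + 1)) (π : Perm (Fin n)) : Prop :=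
  ∃ U : Finset (Fin n), #U ≤ k ∧ (∀ i ∉ U, i.castSucc < v) ∧
    ∀ i ∉ U, ∀ j ∉ U, i < j → π i < π j

noncomputable instance {n k : ℕ} (v : Fin (n + 1)) : DecidablePred (IncreasingOff k v) :=
  Classical.decPred _

/-- The permutation of `Fin (n + 1)` whose last value is `v` and whose other values are in the
same relative order as those of `ρ`. -/
def snocPerm {n : ℕ} (v : Fin (n + 1)) (ρ : Perm (Fin n)) : Perm (Fin (n + 1)) :=
  (finSuccEquiv' (Fin.last n)).trans ((optionCongr ρ).trans (finSuccEquiv' v).symm)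

@[simp]
theorem snocPerm_last {n : ℕ} (v : Fin (n + 1)) (ρ : Perm (Fin n)) :
    snocPerm v ρ (Fin.last n) = v := by
  simp [snocPerm]

@[simp]
theorem snocPerm_castSucc {n : ℕ} (v : Fin (n + 1)) (ρ : Perm (Fin n)) (i : Fin n) :
    snocPerm v ρ i.castSucc = v.succAbove (ρ i) := by
  rw [← Fin.succAbove_last_apply]
  simp only [snocPerm, trans_apply, finSuccEquiv'_succAbove, optionCongr_apply, Option.map_some,
    finSuccEquiv'_symm_some]

theorem snocPerm_bijective (n : ℕ) :
    Function.Bijective fun p : Fin (n + 1) × Perm (Fin n) => snocPerm p.1 p.2 := by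
  rw [Fintype.bijective_iff_injective_and_card]
  refine ⟨?_, by simp [Fintype.card_perm, Nat.factorial_succ]⟩
  rintro ⟨v, ρ⟩ ⟨w, τ⟩ h
  obtain rfl : v = w := by simpa using DFunLike.congr_fun h (Fin.last n)
  refine Prod.ext rfl (Equiv.ext fun i => ?_)
  simpa using DFunLike.congr_fun h i.castSucc

theorem card_filter_perm_succ {n : ℕ} (P : Perm (Fin (n + 1)) → Prop)
    [DecidablePred P] :
    #{π | P π} = ∑ v, #{ρ | P (snocPerm v ρ)} := by
  simp only [card_filter]
  rw [← Fintype.sum_prod_type' (f := fun v ρ => if P (snocPerm v ρ) then 1 else 0)]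
  exact (Fintype.sum_bijective _ (snocPerm_bijective n) _ _ fun _ => rfl).symm

theorem card_filter_perm_inv {n : ℕ} (P : Perm (Fin n) → Prop) [DecidablePred P] :
    #{π : Perm (Fin n) | P π⁻¹} = #{π | P π} := by
  simp only [card_filter]
  exact Fintype.sum_equiv (Equiv.inv _) _ _ fun _ => rfl

namespace IncreasingOff

variable {n k : ℕ}

theorem mono_left {v : Fin (n + 1)} {π : Perm (Fin n)} (h : IncreasingOff k v π) :
    IncreasingOff (k + 1) v π := by
  obtain ⟨U, hU, h⟩ := h
  exact ⟨U, by omega, h⟩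

theorem castSucc_of_succ {v : Fin n} {π : Perm (Fin n)} (h : IncreasingOff k v.succ π) :
    IncreasingOff (k + 1) v.castSucc π := by
  obtain ⟨U, hU, hv, h⟩ := h
  refine ⟨insert v U, (card_insert_le _ _).trans (by omega), fun i hi => ?_,
    fun i hi j hj => h i ?_ j ?_⟩
  · have := hv i (by grind)
    simp only [mem_insert, not_or, Fin.ext_iff, Fin.lt_def, Fin.val_castSucc, Fin.val_succ]
      at *
    omega
  all_goals grind

theorem le_add {v : Fin (n + 1)} {π : Perm (Fin n)} (h : IncreasingOff k v π) :
    n ≤ v + k := by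
  obtain ⟨U, hU, hv, -⟩ := h
  have hsub : Uᶜ.map Fin.castSuccEmb ⊆ Iio v := by
    intro i hi
    obtain ⟨j, hj, rfl⟩ := mem_map.1 hi
    exact mem_Iio.2 (hv j (mem_compl.1 hj))
  have := card_le_card hsub
  rw [card_map, card_compl, Fintype.card_fin, Fin.card_Iio] at this
  omega

theorem inv_last {π : Perm (Fin n)} (h : IncreasingOff k (Fin.last n) π) :
    IncreasingOff k (Fin.last n) π⁻¹ := by
  obtain ⟨U, hU, -, h⟩ := h
  refine ⟨U.map π.toEmbedding, by simpa using hU, fun i _ => Fin.castSucc_lt_last i,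
    fun i hi j hj hij => ?_⟩
  obtain ⟨i, rfl⟩ := π.surjective i
  obtain ⟨j, rfl⟩ := π.surjective j
  simp only [mem_map_equiv, Perm.coe_inv, symm_apply_apply] at *
  by_contra! hji
  rcases hji.eq_or_lt with rfl | hji
  · exact hij.false
  · exact (h j hj i hi hji).asymm hij

@[simp]
theorem inv_last_iff {π : Perm (Fin n)} :
    IncreasingOff k (Fin.last n) π⁻¹ ↔ IncreasingOff k (Fin.last n) π :=
  ⟨fun h => by simpa using h.inv_last, inv_last⟩

theorem zero_last_iff {π : Perm (Fin n)} : IncreasingOff 0 (Fin.last n) π ↔ π = 1 := by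
  constructor
  · rintro ⟨U, hU, -, h⟩
    obtain rfl : U = ∅ := by simpa using hU
    have hm : StrictMono π := fun i j hij => h i (by simp) j (by simp) hij
    have : hm.orderIsoOfSurjective π π.surjective = OrderIso.refl _ := Subsingleton.elim _ _
    exact Equiv.ext fun i => DFunLike.congr_fun this i
  · rintro rfl
    exact ⟨∅, by simp, fun i _ => Fin.castSucc_lt_last i, fun i _ j _ h => h⟩

theorem snocPerm_castSucc_iff {v w : Fin (n + 1)} {τ : Perm (Fin n)} :
    IncreasingOff (k + 1) v.castSucc (snocPerm w τ) ↔ IncreasingOff k v τ := by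
  constructor
  · rintro ⟨U, hU, hv, h⟩
    have hlast : Fin.last n ∈ U := by
      by_contra hl
      have := hv _ hl
      simp only [Fin.lt_def, Fin.val_castSucc, Fin.val_last] at this
      omega
    refine ⟨({i | i.castSucc ∈ U} : Finset (Fin n)), ?_, fun i hi => ?_, fun i hi j hj hij => ?_⟩
    · have hsub : ({i | i.castSucc ∈ U} : Finset (Fin n)).map Fin.castSuccEmb ⊆
          U.erase (Fin.last n) := by
        intro i hi
        obtain ⟨j, hj, rfl⟩ := mem_map.1 hi
        exact mem_erase.2 ⟨(Fin.castSucc_lt_last j).ne, by simpa using hj⟩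
      have := card_le_card hsub
      rw [card_map, card_erase_of_mem hlast] at this
      omega
    · exact Fin.castSucc_lt_castSucc_iff.1 (hv i.castSucc (by simpa using hi))
    · have := h i.castSucc (by simpa using hi) j.castSucc (by simpa using hj)
        (Fin.castSucc_lt_castSucc_iff.2 hij)
      simpa using this
  · rintro ⟨U, hU, hv, h⟩
    refine ⟨insert (Fin.last n) (U.map Fin.castSuccEmb),
      (card_insert_le _ _).trans (by simpa using hU), fun i hi => ?_, fun i hi j hj hij => ?_⟩
    · induction i using Fin.lastCases with
      | last => simp at hi
      | cast i => exact Fin.castSucc_lt_castSucc_iff.2 (hv i (by simp_all))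
    · induction i using Fin.lastCases with
      | last => simp at hi
      | cast i =>
        induction j using Fin.lastCases with
        | last => simp at hj
        | cast j => simpa using h i (by simp_all) j (by simp_all) (by simpa using hij)

theorem snocPerm_last_iff {v : Fin (n + 1)} {ρ : Perm (Fin n)} :
    IncreasingOff (k + 1) (Fin.last _) (snocPerm v ρ) ↔
      IncreasingOff k (Fin.last _) ρ ∨ IncreasingOff (k + 1) v ρ⁻¹ := by
  constructor
  · rintro ⟨U, hU, -, h⟩
    by_cases hlast : Fin.last n ∈ U
    · left
      rw [← snocPerm_castSucc_iff (w := v)]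
      refine ⟨U, hU, fun i hi => ?_, h⟩
      induction i using Fin.lastCases with
      | last => exact absurd hlast hi
      | cast i => simp
    · right
      have hpos : ∀ i, i.castSucc ∉ U → (ρ i).castSucc < v := fun i hi => by
        have := h _ hi _ hlast (Fin.castSucc_lt_last i)
        simpa [Fin.succAbove_lt_iff_castSucc_lt] using this
      refine ⟨({i | (ρ⁻¹ i).castSucc ∈ U} : Finset (Fin n)), ?_, fun i hi => ?_,
        fun i hi j hj hij => ?_⟩
      · refine (card_le_card_of_injOn (fun i => (ρ⁻¹ i).castSucc) (fun i hi => by simpa using hi)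
          ?_).trans hU
        intro i _ j _ hij
        simpa using hij
      · simpa using hpos (ρ⁻¹ i) (by simpa using hi)
      · by_contra! hji
        rcases hji.eq_or_lt with hji | hji
        · exact hij.ne' (ρ⁻¹.injective hji)
        · have := h _ (by simpa using hj) _ (by simpa using hi)
            (Fin.castSucc_lt_castSucc_iff.2 hji)
          simp at this
          exact this.asymm hij
  · rintro (h | ⟨U, hU, hv, h⟩)
    · obtain ⟨U, hU, -, h⟩ := (snocPerm_castSucc_iff (w := v)).2 h
      exact ⟨U, hU, fun i _ => Fin.castSucc_lt_last i, h⟩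
    · refine ⟨U.map (ρ⁻¹.toEmbedding.trans Fin.castSuccEmb), by simpa using hU,
        fun i _ => Fin.castSucc_lt_last i, ?_⟩
      have hmem : ∀ i, i.castSucc ∉ U.map (ρ⁻¹.toEmbedding.trans Fin.castSuccEmb) → ρ i ∉ U :=
        fun i hi hiU => hi (mem_map.2 ⟨ρ i, hiU, by simp⟩)
      intro i hi j hj hij
      induction i using Fin.lastCases with
      | last => exact absurd hij (Fin.le_last j).not_gt
      | cast i =>
        induction j using Fin.lastCases with
        | last =>
          simpa [Fin.succAbove_lt_iff_castSucc_lt] using hv _ (hmem i hi)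
        | cast j =>
          simp only [snocPerm_castSucc, Fin.succAbove_lt_succAbove_iff]
          by_contra! hji
          rcases hji.eq_or_lt with hji | hji
          · exact hij.ne' (by rw [ρ.injective hji])
          · have := h _ (hmem j hj) _ (hmem i hi) hji
            simp only [Perm.coe_inv, symm_apply_apply] at this
            exact this.asymm (by simpa using hij)

theorem one_inv_snocPerm_one_iff {w : Fin (n + 2)} :
    IncreasingOff 1 (Fin.last (n + 1)).castSucc (snocPerm w 1)⁻¹ ↔ n ≤ w := by
  constructor
  · rintro ⟨U, hU, hv, h⟩
    have hlast : Fin.last (n + 1) ∈ U := by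
      by_contra hl
      exact (hv _ hl).false
    have hmem : ∀ i ≠ Fin.last (n + 1), i ∉ U := fun i hi hiU =>
      hi (card_le_one.1 hU _ hiU _ hlast)
    by_contra! hw
    have := h w (hmem _ (by simp [Fin.ext_iff]; omega)) ⟨w + 1, by omega⟩
      (hmem _ (by simp [Fin.ext_iff]; omega)) (by simp [Fin.lt_def])
    have hlw : (snocPerm w 1)⁻¹ w = Fin.last (n + 1) := by
      rw [Perm.inv_eq_iff_eq, snocPerm_last]
    rw [hlw] at this
    exact this.not_ge (Fin.le_last _)
  · intro hw
    refine ⟨{Fin.last (n + 1)}, by simp, fun i hi => ?_, fun i hi j hj hij => ?_⟩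
    · simpa using Fin.lt_last_iff_ne_last.2 (by simpa using hi)
    · obtain ⟨i, rfl⟩ := (snocPerm w 1).surjective i
      obtain ⟨j, rfl⟩ := (snocPerm w 1).surjective j
      simp only [Perm.coe_inv, symm_apply_apply]
      induction i using Fin.lastCases with
      | last =>
        simp only [snocPerm_last, mem_singleton, Fin.ext_iff, Fin.lt_def, Fin.val_last] at *
        omega
      | cast i =>
        induction j using Fin.lastCases with
        | last => exact Fin.castSucc_lt_last i
        | cast j => simpa using hij

end IncreasingOff

/-- The number of permutations of `Fin n` with an increasing subsequence of length `n - k`. -/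
noncomputable def increasingOffCount (k n : ℕ) : ℕ :=
  #{π : Perm (Fin n) | IncreasingOff k (Fin.last n) π}

theorem increasingOffCount_zero (n : ℕ) : increasingOffCount 0 n = 1 := by
  rw [increasingOffCount, card_eq_one]
  exact ⟨1, by ext π; simp [IncreasingOff.zero_last_iff]⟩

theorem card_increasingOff_castSucc_last (k n : ℕ) :
    #{π : Perm (Fin (n + 1)) | IncreasingOff (k + 1) (Fin.last n).castSucc π} =
      (n + 1) * increasingOffCount k n := by
  rw [card_filter_perm_succ]
  simp [IncreasingOff.snocPerm_castSucc_iff, increasingOffCount]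

theorem increasingOffCount_succ (k n : ℕ) :
    increasingOffCount (k + 1) (n + 2) =
      ∑ v : Fin n.succ, #{ρ : Perm (Fin (n + 1)) | IncreasingOff k (Fin.last _) ρ ∨
        IncreasingOff (k + 1) v.castSucc ρ⁻¹} + increasingOffCount (k + 1) (n + 1) := by
  rw [increasingOffCount, card_filter_perm_succ, Fin.sum_univ_castSucc]
  simp only [IncreasingOff.snocPerm_last_iff, IncreasingOff.inv_last_iff]
  congr 2
  ext ρ
  simpa using IncreasingOff.mono_left

theorem card_increasingOff_or_castSucc_last (k n : ℕ) :
    #{ρ : Perm (Fin (n + 1)) | IncreasingOff k (Fin.last _) ρ ∨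
        IncreasingOff (k + 1) (Fin.last n).castSucc ρ⁻¹} = (n + 1) * increasingOffCount k n := by
  rw [← card_increasingOff_castSucc_last, ← card_filter_perm_inv]
  congr 1
  ext ρ
  simp only [inv_inv, IncreasingOff.inv_last_iff, mem_filter_univ, or_iff_right_iff_imp]
  intro h
  exact IncreasingOff.castSucc_of_succ (v := Fin.last n) h

theorem increasingOffCount_one (n : ℕ) : increasingOffCount 1 (n + 1) = 1 + n ^ 2 := by
  induction n with
  | zero =>
    have (π : Perm (Fin 1)) : IncreasingOff 1 (Fin.last 1) π :=
      (IncreasingOff.zero_last_iff.2 (Subsingleton.elim _ _)).mono_left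
    rw [increasingOffCount, filter_true_of_mem fun π _ => this π]
    simp
  | succ n ih =>
    have hlow (v : Fin n) (ρ : Perm (Fin (n + 1))) :
        ¬ IncreasingOff 1 v.castSucc.castSucc ρ := fun h => by
      have := h.le_add
      simp only [Fin.val_castSucc] at this
      omega
    rw [increasingOffCount_succ, Fin.sum_univ_castSucc, ih, card_increasingOff_or_castSucc_last]
    have hzero := increasingOffCount_zero (n + 1)
    rw [increasingOffCount] at hzero
    simp [hlow, hzero, increasingOffCount_zero]
    ring

theorem card_increasingOff_castSucc_last_and_inv (n : ℕ) :
    #{π : Perm (Fin (n + 2)) | IncreasingOff 1 (Fin.last (n + 1)).castSucc π⁻¹ ∧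
      IncreasingOff 1 (Fin.last (n + 1)).castSucc π} = 2 := by
  rw [card_filter_perm_succ]
  simp only [IncreasingOff.snocPerm_castSucc_iff, IncreasingOff.zero_last_iff]
  have (w : Fin (n + 2)) : #{ρ : Perm (Fin (n + 1)) |
      IncreasingOff 1 (Fin.last (n + 1)).castSucc (snocPerm w ρ)⁻¹ ∧ ρ = 1} =
      if n ≤ w then 1 else 0 := by
    split_ifs with hw
    · rw [card_eq_one]
      refine ⟨1, ?_⟩
      ext ρ
      simp only [mem_filter_univ, mem_singleton, and_iff_right_iff_imp]
      rintro rfl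
      exact IncreasingOff.one_inv_snocPerm_one_iff.2 hw
    · rw [card_eq_zero, filter_eq_empty_iff]
      rintro ρ - ⟨h, rfl⟩
      exact hw (IncreasingOff.one_inv_snocPerm_one_iff.1 h)
  simp only [this]
  rw [Fin.sum_univ_castSucc, Fin.sum_univ_castSucc]
  simp

theorem card_increasingOff_castSucc_last_or_inv (n : ℕ) :
    #{π : Perm (Fin (n + 2)) | IncreasingOff 1 (Fin.last (n + 1)).castSucc π⁻¹ ∨
      IncreasingOff 1 (Fin.last (n + 1)).castSucc π} = 2 * (n + 1) := by
  have h := card_union_add_card_inter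
    ({π | IncreasingOff 1 (Fin.last (n + 1)).castSucc π⁻¹} : Finset (Perm (Fin (n + 2))))
    {π | IncreasingOff 1 (Fin.last (n + 1)).castSucc π}
  rw [← filter_or, ← filter_and, card_increasingOff_castSucc_last_and_inv,
    card_filter_perm_inv (IncreasingOff 1 (Fin.last (n + 1)).castSucc),
    card_increasingOff_castSucc_last, increasingOffCount_zero] at h
  omega

theorem card_increasingOff_one_or_two (n : ℕ) :
    #{ρ : Perm (Fin (n + 3)) | IncreasingOff 1 (Fin.last _) ρ ∨
      IncreasingOff 2 (Fin.last (n + 1)).castSucc.castSucc ρ⁻¹} =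
      (n + 1) * (n + 2) + 2 * (n + 1) + increasingOffCount 1 (n + 2) := by
  rw [← card_filter_perm_inv, card_filter_perm_succ]
  have habsorb (τ : Perm (Fin (n + 2))) : IncreasingOff 0 (Fin.last _) τ →
      IncreasingOff 1 (Fin.last (n + 1)).castSucc τ :=
    fun h => IncreasingOff.castSucc_of_succ (v := Fin.last (n + 1)) h
  have hor (v : Fin (n + 3)) (τ : Perm (Fin (n + 2))) :
      ((IncreasingOff 0 (Fin.last _) τ ∨ IncreasingOff 1 v τ⁻¹) ∨
        IncreasingOff 1 (Fin.last (n + 1)).castSucc τ) ↔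
      (IncreasingOff 1 v τ⁻¹ ∨ IncreasingOff 1 (Fin.last (n + 1)).castSucc τ) := by
    have := habsorb τ
    tauto
  have hlow (v : Fin (n + 1)) (ρ : Perm (Fin (n + 2))) :
      ¬ IncreasingOff 1 v.castSucc.castSucc ρ := fun h => by
    have := h.le_add
    simp only [Fin.val_castSucc] at this
    omega
  have hlast (τ : Perm (Fin (n + 2))) : (IncreasingOff 1 (Fin.last _) τ ∨
      IncreasingOff 1 (Fin.last (n + 1)).castSucc τ) ↔ IncreasingOff 1 (Fin.last _) τ := by
    refine or_iff_left_of_imp ?_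
    rintro ⟨U, hU, -, h⟩
    exact ⟨U, hU, fun i _ => Fin.castSucc_lt_last i, h⟩
  have hcard := card_increasingOff_castSucc_last 0 (n + 1)
  rw [increasingOffCount_zero, mul_one, zero_add] at hcard
  simp only [inv_inv, IncreasingOff.inv_last_iff, IncreasingOff.snocPerm_last_iff (k := 0),
    IncreasingOff.snocPerm_castSucc_iff (k := 1), hor]
  rw [Fin.sum_univ_castSucc, Fin.sum_univ_castSucc]
  simp only [IncreasingOff.inv_last_iff, hlow, false_or, hlast,
    card_increasingOff_castSucc_last_or_inv, hcard]
  simp [increasingOffCount]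

theorem increasingOffCount_two_succ (n : ℕ) :
    increasingOffCount 2 (n + 4) = (n + 1) * increasingOffCount 1 (n + 3) +
      ((n + 1) * (n + 2) + 2 * (n + 1) + increasingOffCount 1 (n + 2)) +
      (n + 3) * increasingOffCount 1 (n + 2) + increasingOffCount 2 (n + 3) := by
  have hlow (v : Fin (n + 1)) (ρ : Perm (Fin (n + 3))) :
      ¬ IncreasingOff 2 v.castSucc.castSucc.castSucc ρ := fun h => by
    have := h.le_add
    simp only [Fin.val_castSucc] at this
    omega
  rw [increasingOffCount_succ, Fin.sum_univ_castSucc, Fin.sum_univ_castSucc,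
    card_increasingOff_or_castSucc_last, card_increasingOff_one_or_two]
  simp [hlow, increasingOffCount]

theorem increasingOffCount_two_three : increasingOffCount 2 3 = 6 := by
  have (π : Perm (Fin 3)) : IncreasingOff 2 (Fin.last 3) π := by
    refine ⟨{0, 1}, by simp, fun i _ => Fin.castSucc_lt_last i, fun i hi j hj hij => ?_⟩
    simp only [mem_insert, mem_singleton] at hi hj
    omega
  rw [increasingOffCount, filter_true_of_mem fun π _ => this π, card_univ, Fintype.card_perm]
  rfl

theorem four_mul_increasingOffCount_two (n : ℕ) :
    4 * increasingOffCount 2 (n + 3) =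
      4 + 4 * (n + 2) ^ 2 + ((n + 3) * n) ^ 2 + ((n + 2) * (n + 1)) ^ 2 := by
  induction n with
  | zero => simp [increasingOffCount_two_three]
  | succ n ih =>
    rw [show n + 1 + 3 = n + 4 from rfl, increasingOffCount_two_succ, mul_add, ih,
      increasingOffCount_one, increasingOffCount_one]
    ring

theorem le_lcsLen_iff {α : Type*} {x y : List α} {m : ℕ} :
    m ≤ lcsLen x y ↔ ∃ z : List α, m ≤ z.length ∧ z.Sublist x ∧ z.Sublist y := by
  have hbdd : BddAbove {k | ∃ z : List α, z.length = k ∧ z.Sublist x ∧ z.Sublist y} := by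
    refine ⟨x.length, ?_⟩
    rintro k ⟨z, rfl, hx, -⟩
    exact hx.length_le
  constructor
  · intro h
    obtain ⟨z, hz, hxy⟩ := Nat.sSup_mem
      (s := {k | ∃ z : List α, z.length = k ∧ z.Sublist x ∧ z.Sublist y})
      ⟨0, [], rfl, List.nil_sublist x, List.nil_sublist y⟩ hbdd
    exact ⟨z, h.trans_eq hz.symm, hxy⟩
  · rintro ⟨z, hm, hxy⟩
    exact hm.trans (le_csSup hbdd ⟨z, rfl, hxy⟩)

theorem sublist_permSeq_iff {n : ℕ} {σ : Perm (Fin n)} {z : List ℕ} :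
    z.Sublist (permSeq σ) ↔
      ∃ f : Fin z.length → Fin n, StrictMono f ∧ ∀ i, z.get i = (σ (f i) : ℕ) + 1 := by
  have hlen : (permSeq σ).length = n := by simp [permSeq]
  rw [List.sublist_iff_exists_fin_orderEmbedding_get_eq]
  constructor
  · rintro ⟨f, hf⟩
    refine ⟨fun i => (f i).cast hlen, fun i j hij => ?_, fun i => ?_⟩
    · simpa using hij
    · rw [hf]
      simp [permSeq, Fin.cast]
  · rintro ⟨f, hf, hz⟩
    refine ⟨OrderEmbedding.ofStrictMono (fun i => (f i).cast hlen.symm) fun i j hij => ?_,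
      fun i => ?_⟩
    · simpa using hf hij
    · rw [hz]
      change _ = (permSeq σ).get ((f i).cast hlen.symm)
      simp [permSeq, Fin.cast]

theorem pdist_le_iff {n k : ℕ} {σ π : Perm (Fin n)} :
    pdist σ π ≤ k ↔ IncreasingOff k (Fin.last n) (σ⁻¹ * π) := by
  rw [pdist, Nat.sub_le_iff_le_add, ← Nat.sub_le_iff_le_add', le_lcsLen_iff]
  simp only [sublist_permSeq_iff]
  constructor
  · rintro ⟨z, hz, ⟨f, hf, hfz⟩, ⟨g, hg, hgz⟩⟩
    have hfg (i) : (σ⁻¹ * π) (g i) = f i := by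
      rw [Perm.mul_apply, Perm.inv_eq_iff_eq, Fin.ext_iff]
      have := (hfz i).symm.trans (hgz i)
      omega
    refine ⟨(univ.map ⟨g, hg.injective⟩)ᶜ, ?_, fun i _ => Fin.castSucc_lt_last i, ?_⟩
    · rw [card_compl, card_map]
      simp
      omega
    · simp only [mem_compl, mem_map, mem_univ, true_and, not_not, Function.Embedding.coeFn_mk]
      rintro _ ⟨i, rfl⟩ _ ⟨j, rfl⟩ hij
      rw [hfg, hfg]
      exact hf (hg.lt_iff_lt.1 hij)
  · rintro ⟨U, hU, -, h⟩
    let g := Uᶜ.orderEmbOfFin rfl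
    have hg (i) : g i ∉ U := mem_compl.1 (Uᶜ.orderEmbOfFin_mem rfl i)
    have hlen : (List.ofFn fun i => (π (g i) : ℕ) + 1).length = #Uᶜ := List.length_ofFn
    refine ⟨List.ofFn fun i => (π (g i) : ℕ) + 1, ?_,
      ⟨fun i => (σ⁻¹ * π) (g (i.cast hlen)), ?_, ?_⟩, ⟨fun i => g (i.cast hlen), ?_, ?_⟩⟩
    · rw [hlen, card_compl, Fintype.card_fin]
      omega
    · intro i j hij
      exact h _ (hg _) _ (hg _) (by simpa using hij)
    · intro i
      simp [Fin.cast]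
    · intro i j hij
      simpa using hij
    · intro i
      simp [Fin.cast]

theorem ncard_psphere {n : ℕ} (σ : Perm (Fin n)) (k : ℕ) :
    (psphere σ k).ncard = increasingOffCount k n := by
  have : psphere σ k = Equiv.mulLeft σ ''
      {π : Perm (Fin n) | IncreasingOff k (Fin.last n) π} := by
    ext π
    simp [psphere, pdist_le_iff]
  rw [this, Set.ncard_image_of_injective _ (Equiv.injective _), increasingOffCount,
    ← Set.ncard_coe_finset]
  simp

/-- For `n > 3`,
`|S(σ, 2)| = 1 + (n-1)² + (n(n-3)/2)² + ((n-1)(n-2)/2)²`. -/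
theorem psphere_radius_two_card (n : ℕ) (hn : 3 < n) (σ : Equiv.Perm (Fin n)) :
    (psphere σ 2).ncard =
      1 + (n - 1) ^ 2 + (n * (n - 3) / 2) ^ 2 + ((n - 1) * (n - 2) / 2) ^ 2 := by
  obtain ⟨m, rfl⟩ : ∃ m, n = m + 3 := ⟨n - 3, by omega⟩
  have h := four_mul_increasingOffCount_two m
  obtain ⟨a, ha⟩ : 2 ∣ (m + 3) * m := by
    rw [← even_iff_two_dvd]
    grind
  obtain ⟨b, hb⟩ : 2 ∣ (m + 2) * (m + 1) := by
    rw [← even_iff_two_dvd]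
    grind
  rw [ncard_psphere, show m + 3 - 1 = m + 2 from rfl, show m + 3 - 2 = m + 1 from rfl,
    Nat.add_sub_cancel, ha, hb, Nat.mul_div_cancel_left _ two_pos,
    Nat.mul_div_cancel_left _ two_pos]
  rw [ha, hb] at h
  linarith
end

section
/- Let n be a positive integer and σ ∈ S_n. Then the permutation Ulam sphere of radius 1 centered at σ satisfies S(σ, 1) = {σφ : φ ∈ T_n}, where T_n := {φ(i,j) : i, j ∈ {1,…,n}, i − j ≠ 1} is the unique set of translocations, and moreover |T_n| = |S(σ, 1)| = 1 + (n−1)². -/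
/-- The translocation `φ(i,j)` (0-indexed): for `i ≤ j` it is the cycle
`(i, i+1, …, j)`, sending `k ↦ k+1` for `i ≤ k < j`, `j ↦ i`, and fixing all other
elements (so `φ(i,i)` is the identity); for `i > j` it is the inverse of `φ(j,i)`,
sending `j ↦ i` and `k ↦ k-1` for `j < k ≤ i`. -/
def transloc {n : ℕ} (i j : Fin n) : Equiv.Perm (Fin n) :=
  if i ≤ j then
    (finRotate n ^ (i : ℕ)) * Fin.cycleRange (j - i) * (finRotate n ^ (i : ℕ))⁻¹
  else
    ((finRotate n ^ (j : ℕ)) * Fin.cycleRange (i - j) * (finRotate n ^ (j : ℕ))⁻¹)⁻¹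
/-- The unique set of translocations `T_n = {φ(i,j) : i - j ≠ 1}`. -/
def Tset (n : ℕ) : Set (Equiv.Perm (Fin n)) :=
  {φ | ∃ i j : Fin n, ((i : ℤ) - (j : ℤ) ≠ 1) ∧ φ = transloc i j}

theorem List.Sublist.exists_eq_eraseIdx {α : Type*} {l l' : List α} (h : l.Sublist l')
    (hl : l'.length = l.length + 1) : ∃ i < l'.length, l = l'.eraseIdx i := by
  induction h with
  | slnil => simp at hl
  | cons a h _ =>
    exact ⟨0, by simp, by simpa using h.eq_of_length (by simpa using hl.symm)⟩
  | cons_cons a _ ih =>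
    obtain ⟨i, hi, rfl⟩ := ih (by simpa using hl)
    exact ⟨i + 1, by simpa using hi, by simp⟩

theorem List.eraseIdx_ofFn {α : Type*} {m : ℕ} (f : Fin (m + 1) → α) (i : Fin (m + 1)) :
    (List.ofFn f).eraseIdx i = List.ofFn fun k => f (i.succAbove k) := by
  apply List.ext_getElem
  · simp [List.length_eraseIdx, i.is_le]
  · intro k h₁ h₂
    simp only [List.getElem_eraseIdx, List.getElem_ofFn]
    split_ifs with h <;> congr 1 <;> ext <;> simp [Fin.succAbove, Fin.lt_def, h]

theorem pdist_le_one_iff {m : ℕ} (σ π : Equiv.Perm (Fin (m + 1))) :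
    pdist σ π ≤ 1 ↔
      ∃ i j : Fin (m + 1), ∀ k : Fin m, π (j.succAbove k) = σ (i.succAbove k) := by
  have hbdd : BddAbove {k | ∃ z : List ℕ, z.length = k ∧
      z.Sublist (permSeq σ) ∧ z.Sublist (permSeq π)} :=
    ⟨(permSeq σ).length, by rintro _ ⟨z, rfl, h, -⟩; exact h.length_le⟩
  constructor
  · intro h
    obtain ⟨z, hz, hzσ, hzπ⟩ : lcsLen (permSeq σ) (permSeq π) ∈ {k | ∃ z : List ℕ, z.length = k ∧
        z.Sublist (permSeq σ) ∧ z.Sublist (permSeq π)} :=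
      Nat.sSup_mem ⟨0, [], by simp⟩ hbdd
    have hz' : m ≤ z.length := by
      unfold pdist at h; omega
    have key (τ : Equiv.Perm (Fin (m + 1))) (hτ : z.Sublist (permSeq τ)) :
        ∃ i : Fin (m + 1), z.take m = List.ofFn fun k => (τ (i.succAbove k) : ℕ) + 1 := by
      obtain ⟨i, hi, h⟩ := ((List.take_sublist m z).trans hτ).exists_eq_eraseIdx
        (by simp [permSeq, hz'])
      have hi' : i < m + 1 := by simpa [permSeq] using hi
      exact ⟨⟨i, hi'⟩, h.trans (List.eraseIdx_ofFn (fun i => (τ i : ℕ) + 1) ⟨i, hi'⟩)⟩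
    obtain ⟨i, hi⟩ := key σ hzσ
    obtain ⟨j, hj⟩ := key π hzπ
    refine ⟨i, j, fun k => ?_⟩
    have := congrFun (List.ofFn_injective (hj.symm.trans hi)) k
    exact Fin.ext (by simpa using this)
  · rintro ⟨i, j, h⟩
    have : m ≤ lcsLen (permSeq σ) (permSeq π) := by
      refine le_csSup hbdd ⟨(permSeq σ).eraseIdx i, ?_, List.eraseIdx_sublist _ _, ?_⟩
      · simp [permSeq, List.length_eraseIdx, i.is_le]
      · have : (permSeq σ).eraseIdx i = (permSeq π).eraseIdx j := by
          simp only [permSeq, List.eraseIdx_ofFn, h]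
        rw [this]
        exact List.eraseIdx_sublist _ _
    unfold pdist
    omega

theorem val_finRotate_pow {m : ℕ} (a : ℕ) (k : Fin (m + 1)) :
    ((finRotate (m + 1) ^ a) k : ℕ) = (k + a) % (m + 1) := by
  induction a with
  | zero => simp [Nat.mod_eq_of_lt k.isLt]
  | succ a ih =>
    rw [pow_succ', Equiv.Perm.mul_apply, finRotate_apply, Fin.val_add, ih, Fin.val_one']
    rw [← Nat.add_mod, add_assoc]

theorem val_cycleRange {m : ℕ} (i k : Fin (m + 1)) :
    (i.cycleRange k : ℕ) = if k < i then (k : ℕ) + 1 else if k = i then 0 else k := by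
  split_ifs with h₁ h₂
  · exact Fin.coe_cycleRange_of_lt h₁
  · subst h₂; simp
  · rw [Fin.cycleRange_of_gt (lt_of_le_of_ne (not_lt.1 h₁) (Ne.symm h₂))]

theorem transloc_eq {m : ℕ} (i j : Fin (m + 1)) :
    transloc i j = i.cycleRange⁻¹ * j.cycleRange := by
  have key (i j : Fin (m + 1)) (h : i ≤ j) :
      (finRotate (m + 1) ^ (i : ℕ)) * Fin.cycleRange (j - i) * (finRotate (m + 1) ^ (i : ℕ))⁻¹ =
        i.cycleRange⁻¹ * j.cycleRange := by
    rw [mul_inv_eq_iff_eq_mul, mul_assoc, eq_inv_mul_iff_mul_eq]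
    ext k
    have hr := val_finRotate_pow (i : ℕ) k
    have hs := val_finRotate_pow (i : ℕ) ((j - i).cycleRange k)
    have hd := Fin.sub_val_of_le h
    simp only [Equiv.Perm.mul_apply, val_cycleRange, Fin.lt_def, Fin.ext_iff, hd] at hr hs ⊢
    rw [hr, hs]
    have := k.isLt
    have := j.isLt
    have := Fin.le_def.1 h
    have hmod (a : ℕ) (ha : a < 2 * (m + 1)) :
        a % (m + 1) = if a < m + 1 then a else a - (m + 1) := by
      split_ifs with h
      · exact Nat.mod_eq_of_lt h
      · rw [Nat.mod_eq_sub_mod (by omega), Nat.mod_eq_of_lt (by omega)]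
    rw [hmod (k + i) (by omega)]
    rw [hmod _ (by split_ifs <;> omega)]
    split_ifs <;> omega
  unfold transloc
  split_ifs with h
  · exact key i j h
  · rw [key j i (not_le.1 h).le, mul_inv_rev, inv_inv]

theorem transloc_apply_self {m : ℕ} (i j : Fin (m + 1)) : transloc i j j = i := by
  rw [transloc_eq, Equiv.Perm.mul_apply, Equiv.Perm.inv_eq_iff_eq]
  simp

theorem transloc_succAbove {m : ℕ} (i j : Fin (m + 1)) (k : Fin m) :
    transloc i j (j.succAbove k) = i.succAbove k := by
  rw [transloc_eq, Equiv.Perm.mul_apply, Equiv.Perm.inv_eq_iff_eq]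
  simp

theorem eq_transloc_iff {m : ℕ} (φ : Equiv.Perm (Fin (m + 1))) (i j : Fin (m + 1)) :
    φ = transloc i j ↔ ∀ k, φ (j.succAbove k) = i.succAbove k := by
  refine ⟨fun h k => h ▸ transloc_succAbove i j k, fun h => ?_⟩
  have hk (k) : (φ⁻¹ * transloc i j) (j.succAbove k) = j.succAbove k := by
    rw [Equiv.Perm.mul_apply, transloc_succAbove, Equiv.Perm.inv_eq_iff_eq, h]
  have hj : (φ⁻¹ * transloc i j) j = j := by
    by_contra hne
    obtain ⟨k, hk'⟩ := Fin.exists_succAbove_eq hne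
    exact Fin.succAbove_ne j k ((φ⁻¹ * transloc i j).injective ((hk k).trans hk'))
  refine (inv_mul_eq_one.1 (Equiv.ext fun x => ?_))
  rcases Fin.eq_self_or_eq_succAbove j x with rfl | ⟨k, rfl⟩
  · exact hj
  · exact hk k

theorem val_transloc {m : ℕ} (i j k : Fin (m + 1)) :
    (transloc i j k : ℕ) =
      if k = j then (i : ℕ)
      else if i ≤ k ∧ k < j then (k : ℕ) + 1
      else if j < k ∧ k ≤ i then (k : ℕ) - 1 else k := by
  rcases Fin.eq_self_or_eq_succAbove j k with rfl | ⟨k, rfl⟩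
  · simp [transloc_apply_self]
  · rw [transloc_succAbove]
    simp only [Fin.succAbove, Fin.ext_iff, Fin.lt_def, Fin.le_def, apply_ite Fin.val,
      Fin.val_castSucc, Fin.val_succ]
    split_ifs <;> omega

theorem transloc_self {m : ℕ} (i : Fin (m + 1)) : transloc i i = 1 := by
  rw [transloc_eq, inv_mul_cancel]

theorem transloc_comm_of_sub_eq_one {m : ℕ} {i j : Fin (m + 1)} (h : (i : ℤ) - (j : ℤ) = 1) :
    transloc i j = transloc j i := by
  ext k
  simp only [val_transloc, Fin.ext_iff, Fin.lt_def, Fin.le_def]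
  split_ifs <;> omega

theorem mem_Tset_iff {m : ℕ} {φ : Equiv.Perm (Fin (m + 1))} :
    φ ∈ Tset (m + 1) ↔ ∃ i j, φ = transloc i j := by
  refine ⟨fun ⟨i, j, _, h⟩ => ⟨i, j, h⟩, fun ⟨i, j, h⟩ => ?_⟩
  by_cases hij : (i : ℤ) - (j : ℤ) = 1
  · exact ⟨j, i, by omega, h.trans (transloc_comm_of_sub_eq_one hij)⟩
  · exact ⟨i, j, hij, h⟩

theorem transloc_injOn (m : ℕ) :
    Set.InjOn (fun p : Fin (m + 1) × Fin (m + 1) => transloc p.1 p.2)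
      {p | p.1 ≠ p.2 ∧ (p.1 : ℤ) - (p.2 : ℤ) ≠ 1} := by
  rintro ⟨i, j⟩ ⟨h₁, h₂⟩ ⟨i', j'⟩ ⟨h₁', h₂'⟩ h
  have hk (k : Fin (m + 1)) := congrArg Fin.val (Equiv.congr_fun h k)
  have hi := hk i
  have hj := hk j
  have hi' := hk i'
  have hj' := hk j'
  simp only [val_transloc, Fin.ext_iff, Fin.lt_def, Fin.le_def, Prod.mk.injEq, ne_eq]
    at h₁ h₂ h₁' h₂' hi hj hi' hj' ⊢
  grind

theorem ncard_ne_and_sub_ne_one (m : ℕ) :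
    {p : Fin (m + 1) × Fin (m + 1) | p.1 ≠ p.2 ∧ (p.1 : ℤ) - (p.2 : ℤ) ≠ 1}.ncard = m ^ 2 := by
  classical
  let A : Finset (Fin (m + 1) × Fin (m + 1)) :=
    Finset.univ.image fun k : Fin m => (k.succ, k.castSucc)
  have hcard : A.card = m := by
    rw [Finset.card_image_of_injective _ fun a b h => Fin.succ_injective m (Prod.ext_iff.1 h).1,
      Finset.card_univ, Fintype.card_fin]
  have hA : A ⊆ Finset.univ.offDiag := by
    intro p hp
    obtain ⟨k, -, rfl⟩ := Finset.mem_image.1 hp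
    simp [k.castSucc_lt_succ.ne']
  have heq : {p : Fin (m + 1) × Fin (m + 1) | p.1 ≠ p.2 ∧ (p.1 : ℤ) - (p.2 : ℤ) ≠ 1} =
      ((Finset.univ.offDiag \ A : Finset _) : Set (Fin (m + 1) × Fin (m + 1))) := by
    ext ⟨i, j⟩
    have : (i, j) ∈ A ↔ (i : ℤ) - (j : ℤ) = 1 := by
      simp only [A, Finset.mem_image, Finset.mem_univ, true_and, Prod.mk.injEq, Fin.ext_iff, Fin.val_succ,
        Fin.val_castSucc]
      refine ⟨fun ⟨k, h₁, h₂⟩ => by omega, fun h => ⟨⟨j, by omega⟩, ?_⟩⟩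
      simp only [and_true]
      omega
    simp [this]
  rw [heq, Set.ncard_coe_finset, Finset.card_sdiff_of_subset hA, Finset.offDiag_card, hcard]
  simp only [Finset.card_univ, Fintype.card_fin]
  have : (m + 1) * (m + 1) = m ^ 2 + m + (m + 1) := by ring
  omega

theorem ncard_Tset (m : ℕ) : (Tset (m + 1)).ncard = 1 + m ^ 2 := by
  have h : Tset (m + 1) = insert 1 ((fun p : Fin (m + 1) × Fin (m + 1) => transloc p.1 p.2) ''
      {p | p.1 ≠ p.2 ∧ (p.1 : ℤ) - (p.2 : ℤ) ≠ 1}) := by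
    ext φ
    constructor
    · rintro ⟨i, j, hij, rfl⟩
      by_cases h : i = j
      · subst h; exact Or.inl (transloc_self i)
      · exact Or.inr ⟨(i, j), ⟨h, hij⟩, rfl⟩
    · rintro (rfl | ⟨⟨i, j⟩, ⟨-, hij⟩, rfl⟩)
      · exact ⟨0, 0, by simp, (transloc_self 0).symm⟩
      · exact ⟨i, j, hij, rfl⟩
  rw [h, Set.ncard_insert_of_notMem, (transloc_injOn m).ncard_image, ncard_ne_and_sub_ne_one,
    add_comm]
  rintro ⟨⟨i, j⟩, ⟨hij, -⟩, h⟩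
  exact hij (by simpa [transloc_apply_self] using Equiv.congr_fun h j)

/-- `S(σ,1) = {σφ : φ ∈ T_n}`, and moreover
`|T_n| = |S(σ,1)| = 1 + (n-1)²`. -/
theorem psphere_radius_one_eq_mul_Tset (n : ℕ) (hn : 0 < n) (σ : Equiv.Perm (Fin n)) :
    psphere σ 1 = {π | ∃ φ ∈ Tset n, π = σ * φ} ∧
    (Tset n).ncard = (psphere σ 1).ncard ∧
    (psphere σ 1).ncard = 1 + (n - 1) ^ 2 := by
  obtain ⟨m, rfl⟩ := Nat.exists_eq_succ_of_ne_zero hn.ne'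
  have h : psphere σ 1 = {π | ∃ φ ∈ Tset (m + 1), π = σ * φ} := by
    ext π
    change pdist σ π ≤ 1 ↔ ∃ φ ∈ Tset (m + 1), π = σ * φ
    have (φ : Equiv.Perm (Fin (m + 1))) : π = σ * φ ↔ φ = σ⁻¹ * π := by rw [eq_inv_mul_iff_mul_eq, eq_comm]
    simp only [this, exists_eq_right, mem_Tset_iff, eq_transloc_iff, pdist_le_one_iff,
      Equiv.Perm.mul_apply, Equiv.Perm.inv_eq_iff_eq]
  have hcard : (psphere σ 1).ncard = (Tset (m + 1)).ncard := by
    have himage : {π | ∃ φ ∈ Tset (m + 1), π = σ * φ} = (σ * ·) '' Tset (m + 1) := by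
      ext π
      simp only [Set.mem_ofPred_eq, Set.mem_image, eq_comm]
    rw [h, himage, Set.ncard_image_of_injective _ (mul_right_injective σ)]
  exact ⟨h, hcard.symm, hcard.trans (ncard_Tset m)⟩
end

section
/- Let t be an integer greater than 6 and let n be an integer with n ≥ 2t. Then F(n,t) := ((n−t)!)² · t! / (n! · (n−2t)!) > 1. -/
/-- `F(n,t) = ((n-t)!)² · t! / (n! · (n-2t)!)`, as a real number. -/
noncomputable def Ffun (n t : ℕ) : ℝ :=
  ((n - t).factorial : ℝ) ^ 2 * (t.factorial : ℝ) /
    ((n.factorial : ℝ) * ((n - 2 * t).factorial : ℝ))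

theorem factorial_two_mul_lt_factorial_pow_three {t : ℕ} (ht : 7 ≤ t) :
    (2 * t).factorial < t.factorial ^ 3 := by
  induction t, ht using Nat.le_induction with
  | base => decide
  | succ t ht ih =>
    have hle : (2 * t + 2) * (2 * t + 1) ≤ (t + 1) ^ 3 := by
      nlinarith [Nat.mul_le_mul_left ((t + 1) ^ 2) ht, Nat.zero_le (t ^ 2)]
    calc (2 * (t + 1)).factorial
        = (2 * t + 2) * (2 * t + 1) * (2 * t).factorial := by
          rw [show 2 * (t + 1) = 2 * t + 1 + 1 by ring, Nat.factorial_succ, Nat.factorial_succ]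
          ring
      _ < (t + 1) ^ 3 * t.factorial ^ 3 := Nat.mul_lt_mul_of_le_of_lt hle ih (by positivity)
      _ = (t + 1).factorial ^ 3 := by rw [Nat.factorial_succ, mul_pow]

theorem factorial_mul_factorial_lt {t : ℕ} (ht : 7 ≤ t) (m : ℕ) :
    (2 * t + m).factorial * m.factorial < (t + m).factorial ^ 2 * t.factorial := by
  induction m with
  | zero => simpa [pow_succ] using factorial_two_mul_lt_factorial_pow_three ht
  | succ m ih =>
    have hle : (2 * t + m + 1) * (m + 1) ≤ (t + m + 1) ^ 2 := by nlinarith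
    calc (2 * t + (m + 1)).factorial * (m + 1).factorial
        = (2 * t + m + 1) * (m + 1) * ((2 * t + m).factorial * m.factorial) := by
          rw [← add_assoc, Nat.factorial_succ, Nat.factorial_succ]
          ring
      _ < (t + m + 1) ^ 2 * ((t + m).factorial ^ 2 * t.factorial) :=
          Nat.mul_lt_mul_of_le_of_lt hle ih (by positivity)
      _ = (t + (m + 1)).factorial ^ 2 * t.factorial := by
          rw [← add_assoc, Nat.factorial_succ]
          ring

/-- For `t > 6` and `n ≥ 2t`, `F(n,t) > 1`. -/
theorem one_lt_Ffun_of_six_lt (t n : ℕ) (ht : 6 < t) (hn : 2 * t ≤ n) :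
    1 < Ffun n t := by
  obtain ⟨m, rfl⟩ := Nat.exists_eq_add_of_le hn
  rw [Ffun, one_lt_div (by positivity), show 2 * t + m - t = t + m by lia,
    Nat.add_sub_cancel_left]
  exact_mod_cast factorial_mul_factorial_lt ht m
end

section
/- Let t be a positive integer and n a positive integer with n ≤ 2t + 1. Then no nontrivial perfect t-error correcting permutation code exists in S_n. -/
/-- A perfect `t`-error correcting permutation code in the Ulam metric:
every permutation lies in the radius-`t` Ulam sphere of a unique codeword. -/
noncomputable def IsPerfectPermCode {n : ℕ} (t : ℕ) (C : Set (Equiv.Perm (Fin n))) : Prop :=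
  ∀ σ : Equiv.Perm (Fin n), ∃! c, c ∈ C ∧ σ ∈ psphere c t

theorem permSeq_eq_map {n : ℕ} (σ : Equiv.Perm (Fin n)) :
    permSeq σ = (List.ofFn σ).map fun i : Fin n => (i : ℕ) + 1 := by
  rw [permSeq, List.map_ofFn]
  rfl

theorem pdist_le_of_sublist {n t : ℕ} {σ π : Equiv.Perm (Fin n)} {w : List (Fin n)}
    (hσ : w.Sublist (List.ofFn σ)) (hπ : w.Sublist (List.ofFn π)) (hw : n ≤ w.length + t) :
    pdist σ π ≤ t := by
  have h := length_le_lcsLen (hσ.map fun i : Fin n => (i : ℕ) + 1) (hπ.map fun i : Fin n => (i : ℕ) + 1)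
  rw [← permSeq_eq_map, ← permSeq_eq_map, List.length_map] at h
  unfold pdist
  omega

theorem exists_perm_ofFn_eq {n : ℕ} (z : List (Fin n)) (hz : z.Nodup) (hlen : z.length = n) :
    ∃ σ : Equiv.Perm (Fin n), List.ofFn σ = z := by
  let f : Fin n → Fin n := fun i => z.get (i.cast hlen.symm)
  have hf : Function.Injective f := fun i j hij => by
    simpa using List.nodup_iff_injective_get.mp hz hij
  refine ⟨Equiv.ofBijective f (Finite.injective_iff_bijective.mp hf), ?_⟩
  apply List.ext_get <;> simp [f, hlen]

/-- When `n ≤ 2t + 1`, any two Ulam spheres of radius `t` in `S_n` intersect: keep the first `t`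
symbols of one permutation and append the remaining symbols in the order of the other. -/
theorem exists_mem_psphere_inter {n t : ℕ} (h : n ≤ 2 * t + 1) (c d : Equiv.Perm (Fin n)) :
    ∃ σ, σ ∈ psphere c t ∧ σ ∈ psphere d t := by
  rcases Nat.lt_or_ge t n with htn | htn
  · set x := List.ofFn c with hx
    set y := List.ofFn d with hy
    have hxn : x.Nodup := List.nodup_ofFn.mpr c.injective
    have hyn : y.Nodup := List.nodup_ofFn.mpr d.injective
    have hxl : x.length = n := List.length_ofFn
    have hyx : y.Perm x := by
      rw [List.perm_ext_iff_of_nodup hyn hxn]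
      intro a
      simp only [hx, hy, List.mem_ofFn]
      exact ⟨fun _ => c.surjective a, fun _ => d.surjective a⟩
    have hdisj : List.Disjoint (x.take t) (x.drop t) := List.disjoint_take_drop hxn le_rfl
    set f := y.filter (· ∉ x.take t)
    have hfp : f.Perm (x.drop t) := by
      rw [List.perm_ext_iff_of_nodup (hyn.filter _) (hxn.sublist (List.drop_sublist t x))]
      intro a
      have ha : a ∈ x ↔ a ∈ x.take t ∨ a ∈ x.drop t := by
        rw [← List.mem_append, List.take_append_drop]
      simp only [List.mem_filter, hyx.mem_iff, ha, decide_eq_true_eq]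
      exact ⟨fun h => h.1.resolve_left h.2, fun h => ⟨Or.inr h, fun h' => hdisj h' h⟩⟩
    have hzp : (x.take t ++ f).Perm x := by
      simpa using hfp.append_left (x.take t)
    obtain ⟨σ, hσ⟩ := exists_perm_ofFn_eq _ (hzp.nodup_iff.mpr hxn) (hzp.length_eq.trans hxl)
    have htx : t < x.length := hxl.symm ▸ htn
    have hdrop : x.drop t = x[t] :: x.drop (t + 1) := List.drop_eq_getElem_cons htx
    have hxs : (x.take t ++ [x[t]]).Sublist x := by
      rw [List.take_concat_get' x t htx]
      exact List.take_sublist _ _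
    refine ⟨σ, pdist_le_of_sublist hxs ?_ ?_, pdist_le_of_sublist (w := f) ?_ ?_ ?_⟩
    · rw [hσ]
      refine (List.Sublist.refl _).append (List.singleton_sublist.mpr ?_)
      rw [hfp.mem_iff, hdrop]
      exact List.mem_cons_self
    · simp only [List.length_append, List.length_take, List.length_singleton]
      omega
    · exact List.filter_sublist
    · rw [hσ]
      exact List.sublist_append_right _ _
    · rw [hfp.length_eq, List.length_drop]
      omega
  · exact ⟨c, (Nat.sub_le _ _).trans htn, (Nat.sub_le _ _).trans htn⟩

/-- If `t ≥ 1` and `n ≤ 2t + 1`, then every perfect `t`-error correcting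
permutation code in `S_n` is trivial. -/
theorem no_nontrivial_perfect_code_of_small_n (n t : ℕ) (hn : 0 < n) (ht : 0 < t)
    (h : n ≤ 2 * t + 1) (C : Set (Equiv.Perm (Fin n))) (hC : IsPerfectPermCode t C) :
    C = Set.univ ∨ C.ncard = 1 := by
  right
  obtain ⟨c, ⟨hcC, -⟩, -⟩ := hC 1
  refine Set.ncard_eq_one.mpr ⟨c, Set.Subset.antisymm (fun d hd => ?_) (by simpa using hcC)⟩
  obtain ⟨σ, hσc, hσd⟩ := exists_mem_psphere_inter h c d
  exact (hC σ).unique ⟨hd, hσd⟩ ⟨hcC, hσc⟩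
end

section
/- For every positive integer n and every positive integer t, there does not exist a nontrivial perfect t-error correcting permutation code in S_n under the Ulam metric. -/
theorem List.ofFn_sublist_ofFn_iff {α : Type*} {k n : ℕ} (a : Fin k → α) (b : Fin n → α) :
    (List.ofFn a).Sublist (List.ofFn b) ↔ ∃ f : Fin k ↪o Fin n, ∀ i, a i = b (f i) := by
  rw [List.sublist_iff_exists_fin_orderEmbedding_get_eq]
  constructor
  · rintro ⟨f, hf⟩
    refine ⟨((Fin.castOrderIso (List.length_ofFn (f := a)).symm).toOrderEmbedding.trans f).trans
      (Fin.castOrderIso (List.length_ofFn (f := b))).toOrderEmbedding, fun i => ?_⟩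
    have h := hf (Fin.cast (List.length_ofFn (f := a)).symm i)
    simp only [List.get_ofFn] at h
    exact h
  · rintro ⟨f, hf⟩
    refine ⟨((Fin.castOrderIso (List.length_ofFn (f := a))).toOrderEmbedding.trans f).trans
      (Fin.castOrderIso (List.length_ofFn (f := b)).symm).toOrderEmbedding, fun i => ?_⟩
    have h := hf (Fin.cast (List.length_ofFn (f := a)) i)
    simp only [List.get_ofFn]
    exact h

/-- The Ulam distance is at most `t` iff all but `t` values appear in the same relative order. -/
theorem pdist_le_iff_s12 {n : ℕ} (σ π : Equiv.Perm (Fin n)) (t : ℕ) :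
    pdist σ π ≤ t ↔ ∃ V : Finset (Fin n), n ≤ V.card + t ∧
      ∀ x ∈ V, ∀ y ∈ V, σ.symm x < σ.symm y → π.symm x < π.symm y := by
  set S := {k | ∃ z : List ℕ, z.length = k ∧ z.Sublist (permSeq σ) ∧ z.Sublist (permSeq π)}
    with hS
  have hbdd : BddAbove S := by
    refine ⟨n, ?_⟩
    rintro k ⟨z, rfl, hz, -⟩
    simpa [permSeq] using hz.length_le
  have hne : S.Nonempty := ⟨0, [], rfl, List.nil_sublist _, List.nil_sublist _⟩
  have hmem : ∀ k, k ∈ S ↔ ∃ V : Finset (Fin n), V.card = k ∧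
      ∀ x ∈ V, ∀ y ∈ V, σ.symm x < σ.symm y → π.symm x < π.symm y := by
    intro k
    constructor
    · rintro ⟨z, rfl, h1, h2⟩
      rw [← List.ofFn_get z, permSeq, List.ofFn_sublist_ofFn_iff] at h1 h2
      obtain ⟨f, hf⟩ := h1
      obtain ⟨g, hg⟩ := h2
      have hfg : ∀ i, σ (f i) = π (g i) := fun i => by
        have := (hf i).symm.trans (hg i)
        exact Fin.ext (by omega)
      refine ⟨Finset.univ.map (f.toEmbedding.trans σ.toEmbedding), by simp, ?_⟩
      intro x hx y hy hxy
      simp only [Finset.mem_map, Finset.mem_univ, true_and] at hx hy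
      obtain ⟨i, rfl⟩ := hx
      obtain ⟨j, rfl⟩ := hy
      simp only [Function.Embedding.trans_apply, Equiv.coe_toEmbedding,
        RelEmbedding.coe_toEmbedding, Equiv.symm_apply_apply] at hxy ⊢
      rw [hfg, hfg]
      simpa using hxy
    · rintro ⟨V, rfl, hV⟩
      set e := (V.map σ.symm.toEmbedding).orderEmbOfFin (k := V.card) (by simp) with he
      have heV : ∀ i, σ (e i) ∈ V := fun i => by
        have := Finset.orderEmbOfFin_mem (V.map σ.symm.toEmbedding) (k := V.card) (by simp) i
        rw [← he] at this
        simpa [Finset.mem_map_equiv] using this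
      refine ⟨List.ofFn fun i => (σ (e i) : ℕ) + 1, by simp, ?_, ?_⟩
      · rw [permSeq, List.ofFn_sublist_ofFn_iff]
        exact ⟨e, fun i => rfl⟩
      · rw [permSeq, List.ofFn_sublist_ofFn_iff]
        have hmono : StrictMono fun i => π.symm (σ (e i)) := fun i j hij =>
          hV _ (heV i) _ (heV j) (by simpa using hij)
        exact ⟨OrderEmbedding.ofStrictMono _ hmono, fun i => by simp⟩
  have hdist : pdist σ π = n - sSup S := rfl
  constructor
  · intro h
    obtain ⟨V, hV, hV'⟩ := (hmem _).1 (Nat.sSup_mem hne hbdd)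
    exact ⟨V, by omega, hV'⟩
  · rintro ⟨V, hV, hV'⟩
    have := le_csSup hbdd ((hmem _).2 ⟨V, rfl, hV'⟩)
    omega

theorem toLex_card_filter_lt {α β γ : Type*} [LinearOrder β] [Preorder γ] (V : Finset α)
    (P : α → β) {x y : α} {a b : γ} (hxy : P x < P y) (h : y ∈ V ∨ a < b) :
    toLex ((V.filter fun v => P v ≤ P x).card, a) <
      toLex ((V.filter fun v => P v ≤ P y).card, b) := by
  have hsub : (V.filter fun v => P v ≤ P x) ⊆ V.filter fun v => P v ≤ P y :=
    Finset.monotone_filter_right V fun v _ hv => hv.trans hxy.le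
  rw [Prod.Lex.toLex_lt_toLex]
  rcases h with h | h
  · refine Or.inl (Finset.card_lt_card ⟨hsub, fun h' => ?_⟩)
    have := h' (Finset.mem_filter.2 ⟨h, le_rfl⟩)
    exact absurd (Finset.mem_filter.1 this).2 (not_le.2 hxy)
  · rcases (Finset.card_le_card hsub).lt_or_eq with h' | h'
    · exact Or.inl h'
    · exact Or.inr ⟨h', h⟩

/-- Two permutations at Ulam distance at most `2 * t` have a common point within distance `t`. -/
theorem exists_pdist_le_of_agree {n t : ℕ} (σ π : Equiv.Perm (Fin n)) (V : Finset (Fin n))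
    (hV : n ≤ V.card + 2 * t)
    (h : ∀ x ∈ V, ∀ y ∈ V, σ.symm x < σ.symm y → π.symm x < π.symm y) :
    ∃ τ, pdist σ τ ≤ t ∧ pdist π τ ≤ t := by
  have hVc : (Vᶜ).card ≤ 2 * t := by
    rw [Finset.card_compl, Fintype.card_fin]; omega
  obtain ⟨T, hT, hTc⟩ := Finset.exists_subset_card_eq (min_le_right t (Vᶜ).card)
  have hTV : ∀ x ∈ T, x ∉ V := fun x hx => Finset.mem_compl.1 (hT hx)
  have hiff : ∀ x ∈ V, ∀ y ∈ V, (σ.symm x ≤ σ.symm y ↔ π.symm x ≤ π.symm y) := by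
    intro x hx y hy
    rcases lt_trichotomy (σ.symm x) (σ.symm y) with h' | h' | h'
    · exact iff_of_true h'.le (h x hx y hy h').le
    · rw [σ.symm.injective h']; simp
    · exact iff_of_false (not_le.2 h') (not_le.2 (h y hy x hx h'))
  let tag : Fin n → ℕ := fun x =>
    if x ∈ V then 0 else if x ∈ T then (σ.symm x : ℕ) + 1 else (π.symm x : ℕ) + 1
  let key : Fin n → ℕ ×ₗ ℕ := fun x =>
    if x ∈ V ∪ T then toLex ((V.filter fun v => σ.symm v ≤ σ.symm x).card, tag x)
    else toLex ((V.filter fun v => π.symm v ≤ π.symm x).card, tag x)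
  have key1 : ∀ x ∈ V ∪ T, key x = toLex ((V.filter fun v => σ.symm v ≤ σ.symm x).card, tag x) :=
    fun x hx => if_pos hx
  have key2 : ∀ x ∉ T, key x = toLex ((V.filter fun v => π.symm v ≤ π.symm x).card, tag x) := by
    intro x hx
    by_cases hxV : x ∈ V
    · rw [key1 x (Finset.mem_union_left _ hxV)]
      congr 3
      exact Finset.filter_congr fun v hv => hiff v hv x hxV
    · exact if_neg (by simp [hx, hxV])
  have hτ : ∀ x y, key x < key y → (Tuple.sort key).symm x < (Tuple.sort key).symm y := by
    intro x y hxy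
    by_contra! hle
    have := Tuple.monotone_sort key hle
    simp only [Function.comp_apply, Equiv.apply_symm_apply] at this
    exact absurd this (not_le.2 hxy)
  refine ⟨Tuple.sort key, ?_, ?_⟩
  · rw [pdist_le_iff_s12]
    refine ⟨V ∪ T, ?_, fun x hx y hy hxy => hτ x y ?_⟩
    · rw [Finset.card_union_of_disjoint
        (Finset.disjoint_left.2 fun x hx hx' => hTV x hx' hx), hTc]
      rw [Finset.card_compl, Fintype.card_fin] at *
      omega
    · rw [key1 x hx, key1 y hy]
      refine toLex_card_filter_lt V _ hxy ?_
      rcases Finset.mem_union.1 hy with hy | hy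
      · exact Or.inl hy
      · right
        have := hTV y hy
        by_cases hxV : x ∈ V
        · simp [tag, hxV, hy, this]
        · have hxT : x ∈ T := by simpa [hxV] using hx
          simpa [tag, hxV, hxT, hy, this] using hxy
  · rw [pdist_le_iff_s12]
    refine ⟨Tᶜ, ?_, fun x hx y hy hxy => hτ x y ?_⟩
    · have := Finset.card_compl T
      rw [Fintype.card_fin] at this
      omega
    · rw [Finset.mem_compl] at hx hy
      rw [key2 x hx, key2 y hy]
      refine toLex_card_filter_lt V _ hxy ?_
      by_cases hyV : y ∈ V
      · exact Or.inl hyV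
      · right
        by_cases hxV : x ∈ V
        · simp [tag, hxV, hy, hyV]
        · simpa [tag, hxV, hx, hy, hyV] using hxy

/-- The position sets of size `n - t` on which `ρ` is increasing. -/
def increasingSets {n : ℕ} (t : ℕ) (ρ : Equiv.Perm (Fin n)) : Finset (Finset (Fin n)) :=
  (Finset.powersetCard (n - t) Finset.univ).filter
    fun W => ∀ i ∈ W, ∀ j ∈ W, i < j → ρ i < ρ j

/-- The Ulam ball of radius `t` around the identity. -/
def ulamBall (n t : ℕ) : Finset (Equiv.Perm (Fin n)) :=
  Finset.univ.filter fun ρ => (increasingSets t ρ).Nonempty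

theorem mem_ulamBall_of_pdist_le {n t : ℕ} {σ π : Equiv.Perm (Fin n)} (h : pdist σ π ≤ t) :
    π⁻¹ * σ ∈ ulamBall n t := by
  obtain ⟨V, hV, hV'⟩ := (pdist_le_iff_s12 σ π t).1 h
  obtain ⟨W, hW, hWc⟩ := Finset.exists_subset_card_eq
    (show n - t ≤ (V.map σ.symm.toEmbedding).card by rw [Finset.card_map]; omega)
  refine Finset.mem_filter.2 ⟨Finset.mem_univ _, W, ?_⟩
  refine Finset.mem_filter.2 ⟨Finset.mem_powersetCard.2 ⟨Finset.subset_univ _, hWc⟩, ?_⟩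
  intro i hi j hj hij
  have hmem : ∀ k ∈ W, σ k ∈ V := fun k hk => by
    simpa [Finset.mem_map_equiv] using hW hk
  exact hV' _ (hmem i hi) _ (hmem j hj) (by simpa using hij)

theorem card_perm_increasing_le {n t : ℕ} (ht : t ≤ n) (W : Finset (Fin n))
    (hW : W.card = n - t) :
    (Finset.univ.filter fun ρ : Equiv.Perm (Fin n) =>
      ∀ i ∈ W, ∀ j ∈ W, i < j → ρ i < ρ j).card ≤ n.descFactorial t := by
  classical
  have hcard : Fintype.card ((Wᶜ : Finset (Fin n)) ↪ Fin n) = n.descFactorial t := by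
    rw [Fintype.card_embedding_eq, Fintype.card_fin, Fintype.card_coe, Finset.card_compl,
      Fintype.card_fin, hW]
    congr 1
    omega
  rw [← hcard, ← Finset.card_univ]
  refine Finset.card_le_card_of_injOn
    (fun ρ => (Function.Embedding.subtype _).trans ρ.toEmbedding) (fun _ _ => Finset.mem_univ _) ?_
  intro ρ hρ ρ' hρ' heq
  simp only [Finset.coe_filter, Finset.mem_univ, true_and, Set.mem_ofPred_eq] at hρ hρ'
  have hout : ∀ i ∉ W, ρ i = ρ' i := fun i hi =>
    DFunLike.congr_fun heq ⟨i, Finset.mem_compl.2 hi⟩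
  have himg : W.map ρ.toEmbedding = W.map ρ'.toEmbedding := by
    have hc : ∀ τ : Equiv.Perm (Fin n), W.map τ.toEmbedding = (Wᶜ.map τ.toEmbedding)ᶜ := by
      intro τ
      ext x
      simp [Finset.mem_map_equiv]
    rw [hc, hc]
    congr 1
    ext x
    simp only [Finset.mem_map, Finset.mem_compl, Equiv.coe_toEmbedding]
    refine exists_congr fun i => and_congr_right fun hi => ?_
    rw [hout i hi]
  have huniq : ∀ τ : Equiv.Perm (Fin n), (∀ i ∈ W, ∀ j ∈ W, i < j → τ i < τ j) →
      ∀ hc : (W.map τ.toEmbedding).card = n - t,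
      (fun k => τ (W.orderEmbOfFin hW k)) = (W.map τ.toEmbedding).orderEmbOfFin hc := by
    intro τ hτ hc
    refine Finset.orderEmbOfFin_unique hc (fun k => ?_) fun k l hkl => ?_
    · exact Finset.mem_map.2 ⟨_, Finset.orderEmbOfFin_mem W hW k, rfl⟩
    · exact hτ _ (Finset.orderEmbOfFin_mem W hW k) _ (Finset.orderEmbOfFin_mem W hW l)
        (by simpa using hkl)
  have hWc : (W.map ρ'.toEmbedding).card = n - t := by simpa using hW
  ext1 i
  by_cases hi : i ∈ W
  · have hr : i ∈ Set.range (W.orderEmbOfFin hW) := by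
      rw [Finset.range_orderEmbOfFin]; exact hi
    obtain ⟨k, rfl⟩ := hr
    have h1 := huniq ρ hρ (by simpa using hW)
    have h2 := huniq ρ' hρ' hWc
    simp only [himg] at h1
    exact congrFun (h1.trans h2.symm) k
  · exact hout i hi

theorem sum_card_increasingSets_le {n t : ℕ} (ht : t ≤ n) :
    ∑ ρ : Equiv.Perm (Fin n), (increasingSets t ρ).card ≤ n.choose t * n.descFactorial t := by
  have hswap := Finset.sum_card_bipartiteAbove_eq_sum_card_bipartiteBelow
    (s := (Finset.univ : Finset (Equiv.Perm (Fin n))))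
    (t := Finset.powersetCard (n - t) (Finset.univ : Finset (Fin n)))
    (fun ρ W => ∀ i ∈ W, ∀ j ∈ W, i < j → ρ i < ρ j)
  refine hswap.trans_le ?_
  refine (Finset.sum_le_card_nsmul _ _ (n.descFactorial t) fun W hW => ?_).trans_eq ?_
  · exact card_perm_increasing_le ht W (Finset.mem_powersetCard.1 hW).2
  · rw [Finset.card_powersetCard, Finset.card_univ, Fintype.card_fin, Nat.choose_symm ht,
      smul_eq_mul]

/-- Permutations with several increasing position sets are overcounted by the union bound. -/
theorem card_ulamBall_add_sum_le {n t : ℕ} (ht : t ≤ n) (X : Finset (Equiv.Perm (Fin n))) :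
    (ulamBall n t).card + ∑ ρ ∈ X, (increasingSets t ρ).card ≤
      X.card + n.choose t * n.descFactorial t := by
  have h1 := Finset.sum_add_sum_compl X fun ρ => (increasingSets t ρ).card
  have h2 : (ulamBall n t \ X).card ≤ ∑ ρ ∈ Xᶜ, (increasingSets t ρ).card := by
    rw [Finset.card_eq_sum_ones]
    refine (Finset.sum_le_sum fun ρ hρ => ?_).trans
      (Finset.sum_le_sum_of_subset (f := fun ρ => (increasingSets t ρ).card) ?_)
    · exact Finset.card_pos.2 (Finset.mem_filter.1 (Finset.mem_sdiff.1 hρ).1).2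
    · intro ρ hρ
      exact Finset.mem_compl.2 (Finset.mem_sdiff.1 hρ).2
  have h3 : (ulamBall n t).card ≤ (ulamBall n t \ X).card + X.card := by
    simpa using Finset.card_le_card_sdiff_add_card (s := ulamBall n t) (t := X)
  have h4 := sum_card_increasingSets_le ht
  omega

theorem two_le_card_increasingSets_swap {n : ℕ} {a b : Fin n} (hab : (a : ℕ) + 1 = b) :
    2 ≤ (increasingSets 1 (Equiv.swap a b)).card := by
  have hne : a ≠ b := fun h => by rw [h] at hab; omega
  have hsub : ({Finset.univ.erase a, Finset.univ.erase b} : Finset (Finset (Fin n))) ⊆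
      increasingSets 1 (Equiv.swap a b) := by
    intro W hW
    simp only [Finset.mem_insert, Finset.mem_singleton] at hW
    refine Finset.mem_filter.2 ⟨Finset.mem_powersetCard.2 ⟨Finset.subset_univ _, ?_⟩, ?_⟩
    · rcases hW with rfl | rfl <;> simp
    · intro i hi j hj hij
      rw [Equiv.swap_apply_def, Equiv.swap_apply_def]
      rcases hW with rfl | rfl <;>
      · simp only [Finset.mem_erase, Finset.mem_univ, and_true, ne_eq, Fin.ext_iff] at hi hj
        simp only [Fin.lt_def, Fin.ext_iff] at *
        split_ifs <;> omega
  refine le_trans ?_ (Finset.card_le_card hsub)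
  rw [Finset.card_pair]
  intro h
  have := Finset.ext_iff.1 h a
  simp [hne] at this

theorem card_increasingSets_one {n t : ℕ} (ht : t ≤ n) :
    (increasingSets t (1 : Equiv.Perm (Fin n))).card = n.choose t := by
  rw [increasingSets, Finset.filter_true_of_mem, Finset.card_powersetCard, Finset.card_univ,
    Fintype.card_fin, Nat.choose_symm ht]
  intro W _ i _ j _ hij
  exact hij

theorem card_ulamBall_one_lt {n : ℕ} (hn : 4 ≤ n) : (ulamBall n 1).card < n.descFactorial 2 := by
  obtain ⟨m, rfl⟩ := Nat.exists_eq_add_of_le' hn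
  let a : Fin (m + 4) := ⟨0, by omega⟩
  let b : Fin (m + 4) := ⟨1, by omega⟩
  let c : Fin (m + 4) := ⟨2, by omega⟩
  have hab : a ≠ b := by simp [a, b]
  have hbc : b ≠ c := by simp [b, c]
  have hac : a ≠ c := by simp [a, c]
  have h1 : (1 : Equiv.Perm (Fin (m + 4))) ∉
      ({Equiv.swap a b, Equiv.swap b c} : Finset (Equiv.Perm (Fin (m + 4)))) := by
    simp only [Finset.mem_insert, Finset.mem_singleton, not_or]
    exact ⟨fun h => hab (Equiv.swap_eq_one_iff.1 h.symm),
      fun h => hbc (Equiv.swap_eq_one_iff.1 h.symm)⟩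
  have h2 : Equiv.swap a b ≠ Equiv.swap b c := by
    intro h
    have := Equiv.congr_fun h a
    rw [Equiv.swap_apply_left, Equiv.swap_apply_of_ne_of_ne hab hac] at this
    exact hab this.symm
  have h := card_ulamBall_add_sum_le (n := m + 4) (t := 1) (by omega)
    {1, Equiv.swap a b, Equiv.swap b c}
  rw [Finset.sum_insert h1, Finset.sum_pair h2, Finset.card_insert_of_notMem h1,
    Finset.card_pair h2, card_increasingSets_one (by omega), Nat.choose_one_right] at h
  have h3 := two_le_card_increasingSets_swap (a := a) (b := b) rfl
  have h4 := two_le_card_increasingSets_swap (a := b) (b := c) rfl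
  have h5 : (m + 4).descFactorial 2 = (m + 3) * (m + 4) := by simp [Nat.descFactorial]
  have h6 : (m + 4).descFactorial 1 = m + 4 := by simp [Nat.descFactorial]
  rw [h6] at h
  rw [h5]
  nlinarith

theorem card_ulamBall_six_two_lt : (ulamBall 6 2).card < Nat.descFactorial 6 4 := by
  let g : Fin 6 → Equiv.Perm (Fin 6) := ![1, Equiv.swap 0 1, Equiv.swap 1 2, Equiv.swap 2 3,
    Equiv.swap 3 4, Equiv.swap 4 5]
  let X : Finset (Equiv.Perm (Fin 6)) := Finset.univ.image fun p : Fin 6 × Fin 6 => g p.1 * g p.2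
  have h := card_ulamBall_add_sum_le (n := 6) (t := 2) (by omega) X
  have hsum : X.card + 90 < ∑ ρ ∈ X, (increasingSets 2 ρ).card := by
    decide +kernel
  have h1 : Nat.choose 6 2 * Nat.descFactorial 6 2 = 450 := by decide
  have h2 : Nat.descFactorial 6 4 = 360 := by decide
  omega

theorem card_ulamBall_seven_two_lt : (ulamBall 7 2).card < Nat.descFactorial 7 4 := by
  have h := card_ulamBall_add_sum_le (n := 7) (t := 2) (by omega)
    {1, Equiv.swap 0 1, Equiv.swap 1 2, Equiv.swap 2 3}
  have hX : ({1, Equiv.swap 0 1, Equiv.swap 1 2, Equiv.swap 2 3} :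
      Finset (Equiv.Perm (Fin 7))).card ≤ 4 := Finset.card_le_four
  have hsum : 54 ≤ ∑ ρ ∈ ({1, Equiv.swap 0 1, Equiv.swap 1 2, Equiv.swap 2 3} :
      Finset (Equiv.Perm (Fin 7))), (increasingSets 2 ρ).card := by
    decide +kernel
  have h1 : Nat.choose 7 2 * Nat.descFactorial 7 2 = 882 := by decide
  have h2 : Nat.descFactorial 7 4 = 840 := by decide
  omega

theorem choose_two_mul_add_two_lt_descFactorial {t : ℕ} (ht : 3 ≤ t) :
    (2 * t + 2).choose t < (t + 2).descFactorial t := by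
  induction t, ht using Nat.le_induction with
  | base => decide
  | succ t ht ih =>
    have h1 := Nat.add_one_mul_choose_eq (2 * t + 3) t
    have h2 := Nat.choose_mul_succ_eq (2 * t + 2) t
    have h3 := Nat.succ_descFactorial_succ (t + 2) t
    rw [show 2 * t + 2 + 1 - t = t + 3 by omega] at h2
    rw [show 2 * (t + 1) + 2 = 2 * t + 3 + 1 by ring, show t + 1 + 2 = t + 2 + 1 by ring, h3]
    refine lt_of_mul_lt_mul_right (a := (t + 1) * (t + 3)) ?_ (Nat.zero_le _)
    calc (2 * t + 3 + 1).choose (t + 1) * ((t + 1) * (t + 3))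
        = (2 * t + 3 + 1) * ((2 * t + 2 + 1).choose t * (t + 3)) := by
          rw [← mul_assoc, ← h1, mul_assoc]
      _ = (2 * t + 2).choose t * ((2 * t + 4) * (2 * t + 3)) := by rw [← h2]; ring
      _ ≤ (2 * t + 2).choose t * ((t + 3) * ((t + 1) * (t + 3))) :=
          Nat.mul_le_mul_left _ (by
            obtain ⟨s, rfl⟩ := Nat.exists_eq_add_of_le ht
            ring_nf
            nlinarith [Nat.zero_le (s ^ 3)])
      _ < (t + 2).descFactorial t * ((t + 3) * ((t + 1) * (t + 3))) :=
          Nat.mul_lt_mul_of_pos_right ih (by positivity)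
      _ = (t + 2 + 1) * (t + 2).descFactorial t * ((t + 1) * (t + 3)) := by ring

theorem choose_succ_lt_descFactorial_succ {t k : ℕ}
    (h : (2 * t + k).choose t < (t + k).descFactorial t) :
    (2 * t + (k + 1)).choose t < (t + (k + 1)).descFactorial t := by
  have h1 := Nat.choose_mul_succ_eq (2 * t + k) t
  have h2 := Nat.succ_descFactorial (t + k) t
  rw [show 2 * t + k + 1 - t = t + k + 1 by omega] at h1
  rw [show t + k + 1 - t = k + 1 by omega] at h2
  refine lt_of_mul_lt_mul_right (a := (t + k + 1) * (k + 1)) ?_ (Nat.zero_le _)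
  calc (2 * t + (k + 1)).choose t * ((t + k + 1) * (k + 1))
      = (2 * t + k).choose t * ((2 * t + k + 1) * (k + 1)) := by
        rw [← mul_assoc, ← mul_assoc, h1]; rfl
    _ ≤ (2 * t + k).choose t * ((t + k + 1) * (t + k + 1)) :=
        Nat.mul_le_mul_left _ (by nlinarith)
    _ < (t + k).descFactorial t * ((t + k + 1) * (t + k + 1)) :=
        Nat.mul_lt_mul_of_pos_right h (by positivity)
    _ = (t + k + 1) * ((k + 1) * (t + k + 1).descFactorial t) := by rw [h2]; ring
    _ = (t + (k + 1)).descFactorial t * ((t + k + 1) * (k + 1)) := by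
        rw [← add_assoc]; ring

theorem choose_lt_descFactorial {n t : ℕ} (hn : 2 * t + 2 ≤ n) (ht : 2 ≤ t)
    (h : t = 2 → 8 ≤ n) : n.choose t < (n - t).descFactorial t := by
  obtain ⟨k, rfl⟩ := Nat.exists_eq_add_of_le (show 2 * t ≤ n by omega)
  rw [show 2 * t + k - t = t + k by omega]
  rcases ht.eq_or_lt with rfl | ht
  · induction k, show 4 ≤ k by omega using Nat.le_induction with
    | base => decide
    | succ k hk ih => exact choose_succ_lt_descFactorial_succ (ih (by omega) (by omega))
  · induction k, show 2 ≤ k by omega using Nat.le_induction with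
    | base => exact choose_two_mul_add_two_lt_descFactorial ht
    | succ k hk ih => exact choose_succ_lt_descFactorial_succ (ih (by omega) (by omega))

theorem card_ulamBall_lt {n t : ℕ} (ht : 0 < t) (hn : 2 * t + 2 ≤ n) :
    (ulamBall n t).card < n.descFactorial (2 * t) := by
  rcases Nat.lt_or_ge t 2 with h1 | h2
  · obtain rfl : t = 1 := by omega
    exact card_ulamBall_one_lt hn
  by_cases h6 : t = 2 ∧ n = 6
  · obtain ⟨rfl, rfl⟩ := h6
    exact card_ulamBall_six_two_lt
  by_cases h7 : t = 2 ∧ n = 7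
  · obtain ⟨rfl, rfl⟩ := h7
    exact card_ulamBall_seven_two_lt
  have h := card_ulamBall_add_sum_le (n := n) (t := t) (by omega) ∅
  have hlt := choose_lt_descFactorial hn h2 (by omega)
  have hmul : (n - t).descFactorial t * n.descFactorial t = n.descFactorial (2 * t) := by
    rw [← Nat.descFactorial_mul_descFactorial (show t ≤ 2 * t by omega),
      show 2 * t - t = t by omega]
  simp only [Finset.sum_empty, Finset.card_empty, add_zero, zero_add] at h
  rw [← hmul]
  exact h.trans_lt (Nat.mul_lt_mul_of_pos_right hlt (Nat.descFactorial_pos.2 (by omega)))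

theorem card_le_factorial_of_isPerfectPermCode {n t : ℕ} {C : Finset (Equiv.Perm (Fin n))}
    (hC : IsPerfectPermCode t (C : Set (Equiv.Perm (Fin n)))) : C.card ≤ (n - 2 * t).factorial := by
  have hcard : Fintype.card (Equiv.Perm (Fin (n - 2 * t))) = (n - 2 * t).factorial := by
    rw [Fintype.card_perm, Fintype.card_fin]
  rw [← hcard, ← Finset.card_univ]
  let e : Fin (n - 2 * t) ↪ Fin n := Fin.castLEEmb (Nat.sub_le _ _)
  refine Finset.card_le_card_of_injOn (fun c => Tuple.sort fun i => c.symm (e i))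
    (fun _ _ => Finset.mem_univ _) ?_
  intro c hc d hd hcd
  have hagree : ∀ x ∈ Finset.univ.map e, ∀ y ∈ Finset.univ.map e,
      c.symm x < c.symm y → d.symm x < d.symm y := by
    intro x hx y hy hxy
    simp only [Finset.mem_map, Finset.mem_univ, true_and] at hx hy
    obtain ⟨i, rfl⟩ := hx
    obtain ⟨j, rfl⟩ := hy
    have hmc := Tuple.monotone_sort fun i => c.symm (e i)
    have hmd := Tuple.monotone_sort fun i => d.symm (e i)
    simp only at hcd
    rw [← hcd] at hmd
    set s := Tuple.sort fun i => c.symm (e i)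
    have hij : s.symm i ≤ s.symm j := by
      by_contra! hlt
      have := hmc hlt.le
      simp only [Function.comp_apply, Equiv.apply_symm_apply] at this
      exact absurd this (not_le.2 hxy)
    have hle := hmd hij
    simp only [Function.comp_apply, Equiv.apply_symm_apply] at hle
    refine lt_of_le_of_ne hle fun heq => hxy.ne ?_
    rw [d.symm.injective heq]
  obtain ⟨τ, h1, h2⟩ := exists_pdist_le_of_agree (t := t) c d _ (by simp; omega) hagree
  exact (hC τ).unique ⟨hc, h1⟩ ⟨hd, h2⟩

theorem factorial_le_card_mul_card_ulamBall {n t : ℕ} {C : Finset (Equiv.Perm (Fin n))}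
    (hC : IsPerfectPermCode t (C : Set (Equiv.Perm (Fin n)))) :
    n.factorial ≤ C.card * (ulamBall n t).card := by
  have hcard : n.factorial = Fintype.card (Equiv.Perm (Fin n)) := by
    rw [Fintype.card_perm, Fintype.card_fin]
  rw [hcard, ← Finset.card_product, ← Finset.card_univ]
  refine Finset.card_le_card_of_surjOn (fun p => p.1 * p.2⁻¹) fun τ _ => ?_
  obtain ⟨c, ⟨hc, hcτ⟩, -⟩ := hC τ
  exact ⟨(c, τ⁻¹ * c), by simpa using ⟨hc, mem_ulamBall_of_pdist_le hcτ⟩, by simp⟩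

/-- There are no nontrivial perfect `t`-error correcting permutation
codes in the Ulam metric, for any positive `n` and `t`. -/
theorem no_nontrivial_perfect_ulam_permutation_code (n t : ℕ) (hn : 0 < n) (ht : 0 < t)
    (C : Set (Equiv.Perm (Fin n))) (hC : IsPerfectPermCode t C) :
    C = Set.univ ∨ C.ncard = 1 := by
  right
  lift C to Finset (Equiv.Perm (Fin n)) using C.toFinite
  rw [Set.ncard_coe_finset]
  have hle := card_le_factorial_of_isPerfectPermCode hC
  obtain ⟨c, ⟨hc, -⟩, -⟩ := hC 1
  have hpos : 0 < C.card := Finset.card_pos.2 ⟨c, hc⟩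
  rcases Nat.lt_or_ge n (2 * t + 2) with hlt | hge
  · have : (n - 2 * t).factorial ≤ 1 := (Nat.factorial_le (show n - 2 * t ≤ 1 by omega)).trans_eq rfl
    omega
  · exfalso
    have h1 := factorial_le_card_mul_card_ulamBall hC
    have h2 := card_ulamBall_lt ht hge
    have h3 := Nat.factorial_mul_descFactorial (show 2 * t ≤ n by omega)
    have h4 := Nat.mul_lt_mul_of_pos_left h2 (Nat.factorial_pos (n - 2 * t))
    have h5 := Nat.mul_le_mul_right (ulamBall n t).card hle
    omega
end
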